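/- Let α be an irrational real number with 0 < α < 1, let M_α be the 2×2 rotation matrix with rows (cos 2πα, sin 2πα) and (−sin 2πα, cos 2πα), and let S = {M_α^n : n a positive integer such that there exists a natural number q with |α[1 + 2ℓ(n)] − q/n| < 1/n²}, where ℓ(n) = ⌊log₂ n⌋ and α[k] = ⌊2^k α⌋ / 2^k. Then the topological closure of S in the space of 2×2 real matrices is not semialgebraic. -/

import Mathlib

open Real

/-- The truncation `α[k] = ⌊2^k α⌋ / 2^k` of the binary expansion of `α` to `k` digits. -/
noncomputable def binTrunc (α : ℝ) (k : ℕ) : ℝ := ⌊2 ^ k * α⌋ / 2 ^ k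

/-- A subset of `ℝ^σ` is semialgebraic if it is a finite union of sets of the form
`{x : p(x) = 0 ∧ q₁(x) > 0 ∧ … ∧ q_m(x) > 0}` for real polynomials `p, q₁, …, q_m`. -/
def IsSemialgebraic {σ : Type} [Fintype σ] (A : Set (σ → ℝ)) : Prop :=
  ∃ (k : ℕ) (p : Fin k → MvPolynomial σ ℝ) (q : Fin k → Finset (MvPolynomial σ ℝ)),
    A = ⋃ i, {x | MvPolynomial.eval x (p i) = 0 ∧ ∀ r ∈ q i, 0 < MvPolynomial.eval x r}

/-- A set of matrices is semialgebraic if the corresponding set of entry-vectors is. -/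
def MatSemialgebraic {ι : Type} [Fintype ι] (A : Set (Matrix ι ι ℝ)) : Prop :=
  IsSemialgebraic {x : ι × ι → ℝ | (Matrix.of fun i j => x (i, j)) ∈ A}

/-- The rotation matrix `M_α` by the angle `2πα`. -/
noncomputable def rotMat (α : ℝ) : Matrix (Fin 2) (Fin 2) ℝ :=
  !![Real.cos (2 * π * α), Real.sin (2 * π * α);
     -Real.sin (2 * π * α), Real.cos (2 * π * α)]

open Filter Topology

/-- Arbitrarily large pairs of consecutive one-sided best approximations: `q / n` approximates the
irrational number `α` from below, `p / m` from above, and the two fractions are adjacent. -/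
lemma exists_adjacent_approx (α : ℝ) (hirr : Irrational α) (h0 : 0 < α) (h1 : α < 1) (N : ℕ) :
    ∃ n q m p : ℤ, (N : ℤ) < n ∧ 0 ≤ m ∧ m < n ∧ n * p - m * q = 1 ∧
      0 < n * α - q ∧ n * α - q < p - m * α := by
  induction N with
  | zero => exact ⟨1, 0, 0, 1, by simp, by simp, by simp, by simp, by simpa, by simpa⟩
  | succ N ih =>
    obtain ⟨n, q, m, p, hN, hm, hmn, hdet, hy, hz⟩ := ih
    have hne : ∀ a b : ℤ, a ≠ 0 → (a : ℝ) * α - b ≠ 0 := fun a b ha h ↦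
      (hirr.intCast_mul ha).ne_int b (sub_eq_zero.mp h)
    set y := n * α - q with hydef
    set z := p - m * α with hzdef
    have ha1 : 1 ≤ ⌊z / y⌋ := by
      rw [Int.le_floor, le_div_iff₀ hy]; push_cast; linarith
    have ha2 : (⌊z / y⌋ : ℝ) * y ≤ z := (le_div_iff₀ hy).mp (Int.floor_le _)
    have ha3 : z < (⌊z / y⌋ + 1) * y := (div_lt_iff₀ hy).mp (Int.lt_floor_add_one _)
    set a := ⌊z / y⌋
    have hm' : 0 < m + a * n := by nlinarith
    set z' := z - a * y with hz'def
    have hz'0 : 0 < z' := by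
      refine lt_of_le_of_ne (by linarith) fun h ↦ hne (m + a * n) (p + a * q) hm'.ne' ?_
      push_cast
      rw [hz'def, hzdef, hydef] at h
      linarith
    have hz'y : z' < y := by linarith
    have hb1 : 1 ≤ ⌊y / z'⌋ := by
      rw [Int.le_floor, le_div_iff₀ hz'0]; push_cast; linarith
    have hb2 : (⌊y / z'⌋ : ℝ) * z' ≤ y := (le_div_iff₀ hz'0).mp (Int.floor_le _)
    have hb3 : y < (⌊y / z'⌋ + 1) * z' := (div_lt_iff₀ hz'0).mp (Int.lt_floor_add_one _)
    set b := ⌊y / z'⌋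
    have hbm : m + a * n ≤ b * (m + a * n) := by nlinarith
    have han : n ≤ a * n := by nlinarith
    have hy' : ((n + b * (m + a * n) : ℤ) : ℝ) * α - (q + b * (p + a * q) : ℤ) = y - b * z' := by
      rw [hz'def, hzdef, hydef]; push_cast; ring
    have hz' : ((p + a * q : ℤ) : ℝ) - (m + a * n : ℤ) * α = z' := by
      rw [hz'def, hzdef, hydef]; push_cast; ring
    refine ⟨n + b * (m + a * n), q + b * (p + a * q), m + a * n, p + a * q, ?_, hm'.le, ?_, ?_,
      ?_, ?_⟩
    · push_cast; linarith
    · linarith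
    · linear_combination hdet
    · refine lt_of_le_of_ne (by rw [hy']; linarith) (hne _ _ ?_).symm
      linarith
    · rw [hy', hz']; linarith

lemma abs_sub_sq_mul_lt_one {s D : ℝ} (hs0 : 0 < s) (hs1 : s ≤ 1) (hD1 : 1 ≤ D) (hD2 : D < 2) :
    |s - s ^ 2 * D| < 1 := by
  have h := mul_lt_mul_of_pos_left hD2 (pow_pos hs0 2)
  have h' := mul_pos (pow_pos hs0 2) (zero_lt_one.trans_le hD1)
  rw [abs_lt]
  constructor <;> nlinarith

lemma abs_sub_sq_mul_div_four_lt_one {s F : ℝ} (hs0 : 0 < s) (hs2 : s ≠ 2) (hs : s < 5 / 2)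
    (hF1 : 1 ≤ F) (hF2 : F < 2) : |s - s ^ 2 * (F / 4)| < 1 := by
  have h := mul_lt_mul_of_pos_left hF2 (pow_pos hs0 2)
  have h' := mul_le_mul_of_nonneg_left hF1 (pow_pos hs0 2).le
  have h2 : 0 < (s - 2) ^ 2 := by have := sub_ne_zero.mpr hs2; positivity
  rw [abs_lt]
  constructor <;> nlinarith

lemma abs_neg_add_sq_mul_div_four_lt_one {s E : ℝ} (hs0 : 0 < s) (hs2 : s < 2)
    (hE1 : 1 ≤ E) (hsE : s * E ≤ 4) : |-s + s ^ 2 * (E / 4)| < 1 := by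
  have h := mul_le_mul_of_nonneg_left hsE hs0.le
  have h' := mul_le_mul_of_nonneg_left hE1 (pow_pos hs0 2).le
  rw [abs_lt]
  constructor <;> nlinarith

/-- Two consecutive dyadic ranges `[L, 2L)`, `[2L, 4L)` of denominators, the first of which contains
the denominator of a best approximation of `α` from below, cannot both be free of fractions `j / k`
with `|α - δ - j / k| < 1 / k²`, resp. `|α - δ' - j / k| < 1 / k²`, for `δ` and `δ'` nonnegative
and smaller than `1 / (2L²)`, resp. `1 / (8L²)`. -/
lemma false_of_adjacent_of_forall_one_le_abs {α δ δ' L : ℝ} {n q m p : ℤ} (hL : 0 < L)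
    (hδ0 : 0 ≤ δ) (hδ : δ * (2 * L ^ 2) < 1) (hδ'0 : 0 ≤ δ') (hδ' : δ' * (8 * L ^ 2) < 1)
    (hm : 0 ≤ m) (hmn : m < n) (hdet : n * p - m * q = 1)
    (hy0 : 0 < n * α - q) (hyz : n * α - q < p - m * α) (hn1 : L ≤ n) (hn2 : n < 2 * L)
    (H : ∀ k j : ℤ, L ≤ k → (k : ℝ) < 2 * L → 1 ≤ |k * (k * α - j - k * δ)|)
    (H' : ∀ k j : ℤ, 2 * L ≤ k → (k : ℝ) < 4 * L → 1 ≤ |k * (k * α - j - k * δ')|) :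
    False := by
  have hn0 : (0 : ℝ) < n := hL.trans_le hn1
  have hm0 : (0 : ℝ) ≤ m := by exact_mod_cast hm
  have hmn' : (m : ℝ) < n := by exact_mod_cast hmn
  have hdet' : (n : ℝ) * p - m * q = 1 := by exact_mod_cast hdet
  obtain ⟨r, hr⟩ : ∃ r : ℝ, m = r * n := ⟨m / n, by field_simp⟩
  have hr0 : 0 ≤ r := by nlinarith
  have hr1 : r < 1 := by nlinarith
  set c := n * (n * α - q) with hc
  set t := (n : ℝ) ^ 2 * δ with ht
  set T := 4 * ((n : ℝ) ^ 2 * δ') with hT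
  have hc0 : 0 < c := mul_pos hn0 hy0
  have hcr : c * (1 + r) < 1 := by
    have h : (n * α - q) * (n + m) < 1 := by nlinarith
    calc c * (1 + r) = (n * α - q) * (n + m) := by rw [hc, hr]; ring
      _ < 1 := h
  have hc1 : c < 1 := by nlinarith
  have hnL : (n : ℝ) ^ 2 < 4 * L ^ 2 :=
    (pow_lt_pow_left₀ hn2 hn0.le two_ne_zero).trans_eq (by ring)
  have ht0 : 0 ≤ t := by positivity
  have ht2 : t < 2 := by linarith [mul_le_mul_of_nonneg_right hnL.le hδ0]
  have hT0 : 0 ≤ T := by positivity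
  have hT2 : T < 2 := by linarith [mul_le_mul_of_nonneg_right hnL.le hδ'0]
  have hrow0 : ∀ (i : ℤ) (d : ℝ), ((i * n : ℤ) : ℝ) * ((i * n : ℤ) * α - (i * q : ℤ) -
      (i * n : ℤ) * d) = i ^ 2 * (c - n ^ 2 * d) := fun i d ↦ by
    push_cast; rw [hc]; ring
  have hrow1 : ∀ (i : ℤ) (d : ℝ), ((i * n - m : ℤ) : ℝ) * ((i * n - m : ℤ) * α -
      (i * q - p : ℤ) - (i * n - m : ℤ) * d) = (i - r) + (i - r) ^ 2 * (c - n ^ 2 * d) :=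
    fun i d ↦ by
      push_cast; rw [hr] at hdet' ⊢; rw [hc]; linear_combination (i - r) * hdet'
  have hrow2 : ∀ (i : ℤ) (d : ℝ), ((i * n + m : ℤ) : ℝ) * ((i * n + m : ℤ) * α -
      (i * q + p : ℤ) - (i * n + m : ℤ) * d) = -(i + r) + (i + r) ^ 2 * (c - n ^ 2 * d) :=
    fun i d ↦ by
      push_cast; rw [hr] at hdet' ⊢; rw [hc]; linear_combination (-(i + r)) * hdet'
  have hδt : c - n ^ 2 * δ = -(t - c) := by rw [ht]; ring
  have hδT : c - n ^ 2 * δ' = (4 * c - T) / 4 := by rw [hT]; ring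
  clear_value c t T
  have hD : 1 ≤ t - c := by
    have h := H (1 * n) (1 * q) (by simpa) (by simpa)
    rw [hrow0, hδt, le_abs] at h
    push_cast at h
    rcases h with h | h <;> linarith
  have hLn : 2 * L ^ 2 < n ^ 2 := by
    by_contra! h
    nlinarith
  have hnm : (n : ℝ) - m < L := by
    by_contra! h
    have h := H (1 * n - m) (1 * q - p) (by push_cast; linarith) (by push_cast; linarith)
    rw [hrow1, hδt, mul_neg, ← sub_eq_add_neg, Int.cast_one] at h
    exact h.not_gt <| abs_sub_sq_mul_lt_one (by linarith) (by linarith) hD (by linarith)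
  have hr0' : 0 < r := by
    refine hr0.lt_of_ne fun h ↦ ?_
    rw [← h] at hr
    linarith
  have hE : 1 ≤ 4 * c - T := by
    have h := H' (2 * n) (2 * q) (by push_cast; linarith) (by push_cast; linarith)
    rw [hrow0, hδT, le_abs] at h
    push_cast at h
    rcases h with h | h
    · linarith
    exfalso
    have hF1 : 1 ≤ T - 4 * c := by linarith
    have hF2 : T - 4 * c < 2 := by linarith
    have hδT' : (4 * c - T) / 4 = -((T - 4 * c) / 4) := by ring
    by_cases h2 : 2 * L ≤ 2 * n - m
    · have h := H' (2 * n - m) (2 * q - p) (by push_cast; linarith) (by push_cast; linarith)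
      rw [hrow1, hδT, hδT', mul_neg, ← sub_eq_add_neg, Int.cast_ofNat] at h
      exact h.not_gt <| abs_sub_sq_mul_div_four_lt_one (by linarith) (by linarith) (by linarith)
        hF1 hF2
    · push Not at h2
      have h := H' (3 * n - m) (3 * q - p) (by push_cast; linarith) (by push_cast; linarith)
      have hs : (2 - r) ^ 2 < 2 := by
        have h3 : (2 * n - m : ℝ) ^ 2 < (2 * L) ^ 2 :=
          pow_lt_pow_left₀ h2 (by linarith) (by norm_num)
        have h4 : (2 * n - m : ℝ) ^ 2 = n ^ 2 * (2 - r) ^ 2 := by rw [hr]; ring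
        have h5 : (n : ℝ) ^ 2 * (2 - r) ^ 2 < n ^ 2 * 2 := by linarith
        exact lt_of_mul_lt_mul_left h5 (by positivity)
      have hs' : 2 - r < 3 / 2 := by nlinarith
      rw [hrow1, hδT, hδT', mul_neg, ← sub_eq_add_neg, Int.cast_ofNat] at h
      exact h.not_gt <| abs_sub_sq_mul_div_four_lt_one (by linarith) (by linarith) (by linarith)
        hF1 hF2
  have hnm' : (n : ℝ) + m < 2 * L := by
    by_contra! h
    have h := H' (1 * n + m) (1 * q + p) (by push_cast; linarith) (by push_cast; linarith)
    rw [hrow2, hδT, Int.cast_one] at h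
    exact h.not_gt <| abs_neg_add_sq_mul_div_four_lt_one (by linarith) (by linarith) hE
      (by nlinarith)
  have hn3 : (2 * n : ℝ) ^ 2 < (3 * L) ^ 2 :=
    pow_lt_pow_left₀ (by linarith) (by positivity) two_ne_zero
  have ht3 : t < 9 / 8 := by linarith [mul_le_mul_of_nonneg_right hn3.le hδ0]
  linarith

lemma binTrunc_nonneg {α : ℝ} (h0 : 0 < α) (k : ℕ) : 0 ≤ binTrunc α k := by
  have h : (0 : ℤ) ≤ ⌊2 ^ k * α⌋ := Int.floor_nonneg.mpr (by positivity)
  have h' : (0 : ℝ) ≤ ⌊2 ^ k * α⌋ := by exact_mod_cast h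
  unfold binTrunc
  positivity

lemma binTrunc_le (α : ℝ) (k : ℕ) : binTrunc α k ≤ α := by
  rw [binTrunc, div_le_iff₀ (by positivity), mul_comm α]
  exact Int.floor_le _

lemma sub_binTrunc_mul_lt_one (α : ℝ) (k : ℕ) : (α - binTrunc α k) * 2 ^ k < 1 := by
  have h := Int.lt_floor_add_one (2 ^ k * α)
  rw [sub_mul, binTrunc, div_mul_cancel₀ _ (by positivity)]
  linarith

lemma exists_natCast_abs_sub_div_lt {β : ℝ} (hβ : 0 ≤ β) {k j : ℤ} (hk : 2 ≤ k)
    (h : |(k : ℝ) * (k * β - j)| < 1) : ∃ q : ℕ, |β - (q : ℝ) / k| < 1 / (k : ℝ) ^ 2 := by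
  have hk' : (2 : ℝ) ≤ k := by exact_mod_cast hk
  have hj : 0 ≤ j := by
    by_contra! hj
    have hj' : (j : ℝ) ≤ -1 := by exact_mod_cast Int.le_sub_one_of_lt hj
    have : (0 : ℝ) ≤ k * β := by positivity
    nlinarith [(abs_lt.mp h).2]
  lift j to ℕ using hj
  refine ⟨j, ?_⟩
  rw [lt_div_iff₀ (by positivity)]
  calc |β - (j : ℝ) / k| * (k : ℝ) ^ 2 = |(β - (j : ℝ) / k) * (k : ℝ) ^ 2| := by
        rw [abs_mul, abs_of_pos (by positivity : (0 : ℝ) < k ^ 2)]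
    _ = |(k : ℝ) * (k * β - j)| := by congr 1; field_simp
    _ < 1 := by simpa using h

/-- There are infinitely many `n` for which the truncation of `α` to `1 + 2 ⌊log₂ n⌋` digits is
within `1 / n²` of a fraction with denominator `n`. -/
lemma exists_ge_abs_binTrunc_sub_lt (α : ℝ) (hirr : Irrational α) (h0 : 0 < α) (h1 : α < 1)
    (N : ℕ) : ∃ n : ℕ, N ≤ n ∧ 0 < n ∧
      ∃ q : ℕ, |binTrunc α (1 + 2 * Nat.log 2 n) - (q : ℝ) / n| < 1 / (n : ℝ) ^ 2 := by
  by_contra! H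
  obtain ⟨n, q, m, p, hN, hm, hmn, hdet, hy, hyz⟩ :=
    exists_adjacent_approx α hirr h0 h1 (2 * N + 4)
  lift n to ℕ using by omega
  have hN' : 2 * N + 4 < n := by exact_mod_cast hN
  set l := Nat.log 2 n with hl
  have hl1 : 2 ^ l ≤ n := Nat.pow_log_le_self 2 (by omega)
  have hl2 : n < 2 ^ (l + 1) := Nat.lt_pow_succ_log_self one_lt_two n
  have hlN : N + 2 < 2 ^ l := by rw [pow_succ] at hl2; omega
  have key : ∀ (a : ℕ) (k j : ℤ), l ≤ a → (2 : ℝ) ^ a ≤ k → (k : ℝ) < 2 ^ (a + 1) →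
      1 ≤ |k * (k * α - j - k * (α - binTrunc α (1 + 2 * a)))| := by
    intro a k j hla hk1 hk2
    by_contra! h
    have hk1' : (2 : ℤ) ^ a ≤ k := by exact_mod_cast hk1
    have hk2' : k < (2 : ℤ) ^ (a + 1) := by exact_mod_cast hk2
    lift k to ℕ using le_trans (by positivity) hk1'
    norm_cast at hk1' hk2'
    have hak : 2 ^ l ≤ 2 ^ a := Nat.pow_le_pow_right two_pos hla
    have hlog : Nat.log 2 k = a := Nat.log_eq_of_pow_le_of_lt_pow hk1' hk2'
    obtain ⟨q', hq'⟩ := exists_natCast_abs_sub_div_lt (binTrunc_nonneg h0 (1 + 2 * a))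
      (k := k) (j := j) (by omega) (h.trans_eq' (by congr 1; push_cast; ring))
    refine (H k (by omega) (by omega) q').not_gt ?_
    rwa [Int.cast_natCast, ← hlog] at hq'
  have hpow : (2 : ℝ) ^ (l + 1) = 2 * 2 ^ l := by ring
  have hpow' : (2 : ℝ) ^ (l + 1 + 1) = 4 * 2 ^ l := by ring
  refine false_of_adjacent_of_forall_one_le_abs (L := 2 ^ l) (by positivity)
    (sub_nonneg.mpr (binTrunc_le α (1 + 2 * l)))
    ((sub_binTrunc_mul_lt_one α (1 + 2 * l)).trans_eq' (by ring))
    (sub_nonneg.mpr (binTrunc_le α (1 + 2 * (l + 1))))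
    ((sub_binTrunc_mul_lt_one α (1 + 2 * (l + 1))).trans_eq' (by ring)) hm hmn hdet hy hyz
    (by exact_mod_cast hl1) (by rw [← hpow]; exact_mod_cast hl2) ?_ ?_
  · intro k j hk1 hk2
    exact key l k j le_rfl hk1 (hk2.trans_eq hpow.symm)
  · intro k j hk1 hk2
    exact key (l + 1) k j (by omega) (hpow.trans_le hk1) (hk2.trans_eq hpow'.symm)

lemma abs_mul_sub_lt_three_div {α : ℝ} {n q : ℕ} (hn : 0 < n)
    (h : |binTrunc α (1 + 2 * Nat.log 2 n) - (q : ℝ) / n| < 1 / (n : ℝ) ^ 2) :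
    |n * α - q| < 3 / n := by
  have hn' : (0 : ℝ) < n := by exact_mod_cast hn
  set β := binTrunc α (1 + 2 * Nat.log 2 n) with hβ
  have h1 : 0 ≤ α - β := sub_nonneg.mpr (binTrunc_le _ _)
  have h2 : (α - β) * n ^ 2 < 2 := by
    have h3 := sub_binTrunc_mul_lt_one α (1 + 2 * Nat.log 2 n)
    have h4 : (n : ℝ) < 2 ^ (Nat.log 2 n + 1) := by
      exact_mod_cast Nat.lt_pow_succ_log_self one_lt_two n
    have h5 : (n : ℝ) ^ 2 < 2 * 2 ^ (1 + 2 * Nat.log 2 n) :=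
      (pow_lt_pow_left₀ h4 hn'.le two_ne_zero).trans_eq (by ring)
    have h6 := mul_le_mul_of_nonneg_left h5.le h1
    linarith
  rw [lt_div_iff₀ hn']
  rw [lt_div_iff₀ (by positivity)] at h
  calc |n * α - q| * n = |(α - β) * n ^ 2 + (β - q / n) * n ^ 2| := by
        rw [← abs_of_pos hn', ← abs_mul, abs_of_pos hn']; congr 1; field_simp; ring
    _ ≤ |(α - β) * n ^ 2| + |(β - q / n) * n ^ 2| := abs_add_le _ _
    _ < 2 + 1 := by
        refine add_lt_add ?_ ?_
        · rwa [abs_of_nonneg (by positivity)]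
        · rwa [abs_mul, abs_of_pos (by positivity : (0 : ℝ) < n ^ 2)]
    _ = 3 := by norm_num

lemma rotMat_zero : rotMat 0 = 1 := by
  ext i j; fin_cases i <;> fin_cases j <;> simp [rotMat]

lemma rotMat_add (a b : ℝ) : rotMat (a + b) = rotMat a * rotMat b := by
  have h : 2 * π * (a + b) = 2 * π * a + 2 * π * b := by ring
  ext i j
  fin_cases i <;> fin_cases j <;>
    simp [rotMat, Matrix.mul_apply, Fin.sum_univ_two, h, Real.cos_add, Real.sin_add] <;> ring

lemma rotMat_pow (a : ℝ) (n : ℕ) : rotMat a ^ n = rotMat (n * a) := by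
  induction n with
  | zero => simp [rotMat_zero]
  | succ n ih => rw [pow_succ, ih, ← rotMat_add]; congr 1; push_cast; ring

lemma rotMat_eq_iff {a b : ℝ} : rotMat a = rotMat b ↔ ∃ k : ℤ, a = b + k := by
  constructor
  · intro h
    have h1 : Real.cos (2 * π * a) = Real.cos (2 * π * b) := congr_fun (congr_fun h 0) 0
    have h2 : Real.sin (2 * π * a) = Real.sin (2 * π * b) := congr_fun (congr_fun h 0) 1
    obtain ⟨k, hk⟩ := Real.Angle.angle_eq_iff_two_pi_dvd_sub.mp (Real.Angle.cos_sin_inj h1 h2)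
    refine ⟨k, ?_⟩
    have h3 : 2 * π * a = 2 * π * (b + k) := by linarith
    exact mul_left_cancel₀ (by positivity) h3
  · rintro ⟨k, rfl⟩
    have h : 2 * π * (b + k) = 2 * π * b + k * (2 * π) := by ring
    simp [rotMat, h, Real.cos_add_int_mul_two_pi, Real.sin_add_int_mul_two_pi]

lemma analyticAt_rotMat (i j : Fin 2) (t : ℝ) : AnalyticAt ℝ (fun s ↦ rotMat s i j) t := by
  fin_cases i <;> fin_cases j <;> simp only [rotMat] <;> simp <;> fun_prop

lemma continuous_rotMat : Continuous rotMat :=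
  continuous_matrix fun i j ↦
    continuous_iff_continuousAt.mpr fun t ↦ (analyticAt_rotMat i j t).continuousAt

/-- A semialgebraic set of matrices containing rotations of arbitrarily small nonzero angle contains
uncountably many rotations. -/
lemma MatSemialgebraic.not_countable_preimage_rotMat {A : Set (Matrix (Fin 2) (Fin 2) ℝ)}
    (hA : MatSemialgebraic A) (hfreq : ∃ᶠ t in 𝓝[≠] 0, rotMat t ∈ A) :
    ¬ (rotMat ⁻¹' A).Countable := by
  intro hcount
  obtain ⟨k, p, q, hpq⟩ := hA
  let γ : ℝ → Fin 2 × Fin 2 → ℝ := fun t x ↦ rotMat t x.1 x.2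
  have hmem : ∀ t, rotMat t ∈ A ↔ ∃ i, MvPolynomial.eval (γ t) (p i) = 0 ∧
      ∀ r ∈ q i, 0 < MvPolynomial.eval (γ t) r := fun t ↦ by
    have h : rotMat t ∈ A ↔ γ t ∈ ⋃ i, {x | MvPolynomial.eval x (p i) = 0 ∧
        ∀ r ∈ q i, 0 < MvPolynomial.eval x r} := Set.ext_iff.mp hpq (γ t)
    exact h.trans Set.mem_iUnion
  have han : ∀ (r : MvPolynomial (Fin 2 × Fin 2) ℝ) (t : ℝ),
      AnalyticAt ℝ (fun s ↦ MvPolynomial.eval (γ s) r) t := fun r t ↦ by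
    simpa only [MvPolynomial.aeval_eq_eval] using
      AnalyticAt.aeval_mvPolynomial (fun x ↦ analyticAt_rotMat x.1 x.2 t) r
  obtain ⟨i, hi⟩ := Filter.frequently_exists.mp (hfreq.mono fun t ht ↦ (hmem t).mp ht)
  have hzero := (han (p i) 0).frequently_zero_iff_eventually_zero.mp (hi.mono fun t ht ↦ ht.1)
  obtain ⟨t, ht, htz⟩ :=
    (hi.and_eventually (nhdsWithin_le_nhds hzero.eventually_nhds)).exists
  have hpos : ∀ᶠ s in 𝓝 t, ∀ r ∈ q i, 0 < MvPolynomial.eval (γ s) r :=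
    (Filter.eventually_all_finset _).mpr fun r hr ↦
      (han r t).continuousAt.eventually_const_lt (ht.2 r hr)
  have hsub : rotMat ⁻¹' A ∈ 𝓝 t := by
    filter_upwards [htz, hpos] with s hs1 hs2
    exact (hmem s).mpr ⟨i, hs1, hs2⟩
  have hdense := interior_eq_empty_iff_dense_compl.mpr (hcount.dense_compl ℝ)
  have hint := mem_interior_iff_mem_nhds.mpr hsub
  rw [hdense] at hint
  exact hint

/-- For irrational `0 < α < 1`, the closure of
`S = {M_α^n : n > 0 and ∃ q ∈ ℕ, |α[1 + 2⌊log₂ n⌋] − q/n| < 1/n²}` is not semialgebraic. -/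
theorem closure_rot_powers_not_semialgebraic (α : ℝ) (hirr : Irrational α)
    (h0 : 0 < α) (h1 : α < 1) :
    ¬ MatSemialgebraic (closure
      {X : Matrix (Fin 2) (Fin 2) ℝ | ∃ n : ℕ, 0 < n ∧
        (∃ q : ℕ, |binTrunc α (1 + 2 * Nat.log 2 n) - (q : ℝ) / n| < 1 / (n : ℝ) ^ 2) ∧
        X = rotMat α ^ n}) := by
  set S := {X : Matrix (Fin 2) (Fin 2) ℝ | ∃ n : ℕ, 0 < n ∧
        (∃ q : ℕ, |binTrunc α (1 + 2 * Nat.log 2 n) - (q : ℝ) / n| < 1 / (n : ℝ) ^ 2) ∧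
        X = rotMat α ^ n}
  let G := {n : ℕ | 0 < n ∧
    ∃ q : ℕ, |binTrunc α (1 + 2 * Nat.log 2 n) - (q : ℝ) / n| < 1 / (n : ℝ) ^ 2}
  choose q hq using fun n : G ↦ n.2.2
  let ε : G → ℝ := fun n ↦ n * α - q n
  have hrot : ∀ n : G, rotMat α ^ (n : ℕ) = rotMat (ε n) := fun n ↦ by
    rw [rotMat_pow, rotMat_eq_iff]
    exact ⟨q n, by simp [ε]⟩
  have hε0 : ∀ n : G, ε n ≠ 0 := fun n h ↦
    (hirr.natCast_mul n.2.1.ne').ne_nat (q n) (sub_eq_zero.mp h)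
  have hε : Tendsto ε cofinite (𝓝 0) := by
    have hlim : Tendsto (fun n : G ↦ (3 : ℝ) / (n : ℕ)) cofinite (𝓝 0) :=
      (tendsto_const_div_atTop_nhds_zero_nat 3).comp
        (Nat.cofinite_eq_atTop ▸ Subtype.val_injective.tendsto_cofinite)
    exact squeeze_zero_norm (fun n ↦ (abs_mul_sub_lt_three_div n.2.1 (hq n)).le) hlim
  have hSrange : S = Set.range fun n : G ↦ rotMat (ε n) := by
    ext X
    constructor
    · rintro ⟨n, hn, hq', rfl⟩
      exact ⟨⟨n, hn, hq'⟩, (hrot _).symm⟩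
    · rintro ⟨n, rfl⟩
      exact ⟨n, n.2.1, n.2.2, (hrot n).symm⟩
  have hclosed : IsClosed (insert (rotMat 0) S) := by
    rw [hSrange]
    exact ((continuous_rotMat.tendsto 0).comp hε).isCompact_insert_range_of_cofinite.isClosed
  have hclosure : closure S ⊆ insert (rotMat 0) S :=
    closure_minimal (Set.subset_insert _ _) hclosed
  have hinf : Infinite G := by
    refine Set.infinite_coe_iff.mpr (Set.infinite_of_not_bddAbove fun ⟨b, hb⟩ ↦ ?_)
    obtain ⟨n, hn, hn0, hq'⟩ := exists_ge_abs_binTrunc_sub_lt α hirr h0 h1 (b + 1)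
    have := hb (show n ∈ G from ⟨hn0, hq'⟩)
    omega
  intro hsemi
  refine hsemi.not_countable_preimage_rotMat ?_ ?_
  · have hε' : Tendsto ε cofinite (𝓝[≠] 0) :=
      tendsto_nhdsWithin_iff.mpr ⟨hε, Eventually.of_forall hε0⟩
    refine hε'.frequently (Frequently.of_forall fun n ↦ subset_closure ?_)
    rw [hSrange]
    exact Set.mem_range_self n
  · refine (Set.countable_range fun x : ℕ × ℤ ↦ x.1 * α + (x.2 : ℝ)).mono fun t ht ↦ ?_
    rcases hclosure ht with h | ⟨n, -, -, h⟩
    · obtain ⟨k, hk⟩ := rotMat_eq_iff.mp h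
      exact ⟨(0, k), by simp [hk]⟩
    · rw [rotMat_pow] at h
      obtain ⟨k, hk⟩ := rotMat_eq_iff.mp h
      exact ⟨(n, k), hk.symm⟩
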